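/- arXiv:2411.04085 — 4 statements merged into one kernel-verified Lean document; each statement's English description precedes it below -/
import Mathlib

section
/- For every natural number k ≥ 1 and all real numbers r, s with 0 ≤ r ≤ 1 and 0 ≤ s ≤ 2r, one has k·s ≥ r^k − (r − s)^k. -/
/-- Proposition 3: for every natural number `k ≥ 1` and real numbers `r, s` with
`0 ≤ r ≤ 1` and `0 ≤ s ≤ 2r`, one has `k·s ≥ r^k − (r − s)^k`. -/
theorem stmt_0 (k : ℕ) (hk : 1 ≤ k) (r s : ℝ) (hr0 : 0 ≤ r) (hr1 : r ≤ 1)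
    (hs0 : 0 ≤ s) (hs2 : s ≤ 2 * r) :
    (k : ℝ) * s ≥ r ^ k - (r - s) ^ k := by
  clear hk
  induction k with
  | zero => simp
  | succ n ih =>
    have h1 : (r - s) ^ n ≤ 1 := by
      have h : |r - s| ≤ 1 := abs_le.mpr ⟨by linarith, by linarith⟩
      calc (r - s) ^ n ≤ |(r - s) ^ n| := le_abs_self _
        _ = |r - s| ^ n := abs_pow _ _
        _ ≤ 1 := pow_le_one₀ (abs_nonneg _) h
    have h2 : r * (r ^ n - (r - s) ^ n) ≤ r * (n * s) := mul_le_mul_of_nonneg_left ih hr0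
    have hns : 0 ≤ (n : ℝ) * s := by positivity
    have h3 : r * (n * s) ≤ n * s := mul_le_of_le_one_left hns hr1
    have h4 : (r - s) ^ n * s ≤ s := mul_le_of_le_one_left hs0 h1
    have h5 : r ^ (n + 1) - (r - s) ^ (n + 1)
        = r * (r ^ n - (r - s) ^ n) + (r - s) ^ n * s := by ring
    push_cast
    linarith
end

section
/- For every natural number n and all real numbers r, s with 0 ≤ s ≤ r ≤ 1, one has s·(1 − r^n) + ((r − s)^n − r^n)·(r − 1 − s) ≥ 0. -/
/-- Key step of Proposition 3 (case `s ≤ r`): for every natural number `n` and real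
numbers `r, s` with `0 ≤ s ≤ r ≤ 1`,
`s·(1 − r^n) + ((r − s)^n − r^n)·(r − 1 − s) ≥ 0`. -/
theorem stmt_1 (n : ℕ) (r s : ℝ) (hs0 : 0 ≤ s) (hsr : s ≤ r) (hr1 : r ≤ 1) :
    s * (1 - r ^ n) + ((r - s) ^ n - r ^ n) * (r - 1 - s) ≥ 0 := by
  have h1 : r ^ n ≤ 1 := pow_le_one₀ (hs0.trans hsr) hr1
  have h2 : (r - s) ^ n ≤ r ^ n := pow_le_pow_left₀ (by linarith) (by linarith) n
  exact add_nonneg (mul_nonneg hs0 (by linarith))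
    (mul_nonneg_of_nonpos_of_nonpos (by linarith) (by linarith))
end

section
/- Fix natural numbers N ≥ 1, T, Q. Let H = EuclideanSpace ℂ over the index type Fin N × Bool × ι for a finite type ι. For x ∈ Fin N let O_x be the diagonal unitary on H that negates exactly the coordinates (i, b, w) with i = x and b = true, and leaves the other coordinates fixed. Let ψ₀ ∈ H be a unit vector, let U_1, …, U_T be unitary operators on H, and let S ⊆ {1, …, T} with |S| = Q be the set of query steps. For each x define ψ_t^x recursively by ψ_0^x = ψ₀ and ψ_t^x = U_t(O_x ψ_{t-1}^x) if t ∈ S, ψ_t^x = U_t ψ_{t-1}^x otherwise; define ψ_t by the same recursion with O_x replaced by the identity. Then ∑_{x=1}^{N} ‖ψ_T − ψ_T^x‖² ≤ 4Q². -/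
/-- The total query disturbance over all oracles is at most `4‖v‖²`. -/
theorem sum_oracle_diff_le {N : ℕ} {ι : Type*} [Fintype ι]
    (O : Fin N → (EuclideanSpace ℂ (Fin N × Bool × ι) ≃ₗᵢ[ℂ]
      EuclideanSpace ℂ (Fin N × Bool × ι)))
    (hO : ∀ (x : Fin N) (v : EuclideanSpace ℂ (Fin N × Bool × ι))
      (i : Fin N) (b : Bool) (w : ι),
      O x v (i, b, w) = (if i = x ∧ b = true then -1 else 1) * v (i, b, w))
    (v : EuclideanSpace ℂ (Fin N × Bool × ι)) :
    ∑ x : Fin N, ‖v - O x v‖ ^ 2 ≤ 4 * ‖v‖ ^ 2 := by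
  simp only [EuclideanSpace.norm_sq_eq]
  rw [Finset.sum_comm, Finset.mul_sum]
  refine Finset.sum_le_sum ?_
  rintro ⟨i, b, w⟩ -
  calc ∑ x : Fin N, ‖(v - O x v) (i, b, w)‖ ^ 2
      ≤ ∑ x : Fin N, if i = x then 4 * ‖v (i, b, w)‖ ^ 2 else 0 := by
        refine Finset.sum_le_sum fun x _ => ?_
        rw [PiLp.sub_apply, hO]
        by_cases h : i = x
        · by_cases hb : b = true
          · rw [if_pos ⟨h, hb⟩, if_pos h]
            have : v (i, b, w) - -1 * v (i, b, w) = 2 * v (i, b, w) := by ring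
            rw [this, norm_mul, mul_pow]
            norm_num
          · rw [if_neg (fun h' => hb h'.2), if_pos h, one_mul, sub_self, norm_zero]
            rw [zero_pow two_ne_zero]
            positivity
        · rw [if_neg (fun h' => h h'.1), if_neg h, one_mul, sub_self, norm_zero]
          norm_num
    _ = 4 * ‖v (i, b, w)‖ ^ 2 := by simp

/-- Hybrid argument of Bennett–Bernstein–Brassard–Vazirani (Lemma 2.1 of the paper).
`H = EuclideanSpace ℂ (Fin N × Bool × ι)`; for `x : Fin N`, `O x` is the diagonal
unitary negating exactly the coordinates `(i, b, w)` with `i = x` and `b = true`.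
Starting from a unit vector `ψ₀` and applying unitaries `U_1, …, U_T`, inserting an
oracle call just before `U_t` exactly at the `Q` steps `t ∈ S ⊆ {1, …, T}`, the states
`ψ T` (identity oracle) and `ψx x T` (oracle `O x`) satisfy
`∑_{x=1}^{N} ‖ψ T − ψx x T‖² ≤ 4Q²`. -/
theorem stmt_8 (N T Q : ℕ) {ι : Type*} [Fintype ι]
    (O : Fin N → (EuclideanSpace ℂ (Fin N × Bool × ι) ≃ₗᵢ[ℂ]
      EuclideanSpace ℂ (Fin N × Bool × ι)))
    (hO : ∀ (x : Fin N) (v : EuclideanSpace ℂ (Fin N × Bool × ι))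
      (i : Fin N) (b : Bool) (w : ι),
      O x v (i, b, w) = (if i = x ∧ b = true then -1 else 1) * v (i, b, w))
    (ψ₀ : EuclideanSpace ℂ (Fin N × Bool × ι)) (hψ₀ : ‖ψ₀‖ = 1)
    (U : ℕ → (EuclideanSpace ℂ (Fin N × Bool × ι) ≃ₗᵢ[ℂ]
      EuclideanSpace ℂ (Fin N × Bool × ι)))
    (S : Finset ℕ) (hS : S ⊆ Finset.Icc 1 T) (hScard : S.card = Q)
    (ψ : ℕ → EuclideanSpace ℂ (Fin N × Bool × ι))
    (ψx : Fin N → ℕ → EuclideanSpace ℂ (Fin N × Bool × ι))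
    (hψ0 : ψ 0 = ψ₀) (hψx0 : ∀ x, ψx x 0 = ψ₀)
    (hψrec : ∀ t : ℕ, ψ (t + 1) = U (t + 1) (ψ t))
    (hψxrec : ∀ (x : Fin N) (t : ℕ),
      ψx x (t + 1) =
        if t + 1 ∈ S then U (t + 1) (O x (ψx x t)) else U (t + 1) (ψx x t)) :
    ∑ x : Fin N, ‖ψ T - ψx x T‖ ^ 2 ≤ 4 * (Q : ℝ) ^ 2 := by
  have hnorm : ∀ t, ‖ψ t‖ = 1 := by
    intro t
    induction t with
    | zero => rw [hψ0, hψ₀]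
    | succ t ih => rw [hψrec, LinearIsometryEquiv.norm_map, ih]
  have hd : ∀ (x : Fin N) (t : ℕ), ‖ψ t - ψx x t‖ ≤
      ∑ s ∈ S with s ∈ Finset.Icc 1 t, ‖ψ (s - 1) - O x (ψ (s - 1))‖ := by
    intro x t
    induction t with
    | zero => simp [hψ0, hψx0]
    | succ t ih =>
      rw [hψrec, hψxrec]
      split_ifs with h
      · have hf : S.filter (fun s => s ∈ Finset.Icc 1 (t + 1)) =
            insert (t + 1) (S.filter (fun s => s ∈ Finset.Icc 1 t)) := by
          ext s
          simp only [Finset.mem_filter, Finset.mem_Icc, Finset.mem_insert]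
          constructor
          · rintro ⟨h1, h2, h3⟩
            by_cases hs : s = t + 1
            · exact Or.inl hs
            · exact Or.inr ⟨h1, h2, by omega⟩
          · rintro (rfl | ⟨h1, h2, h3⟩)
            · exact ⟨h, by omega, le_rfl⟩
            · exact ⟨h1, h2, by omega⟩
        rw [hf, Finset.sum_insert (by simp), Nat.add_sub_cancel, ← map_sub,
          LinearIsometryEquiv.norm_map]
        calc ‖ψ t - O x (ψx x t)‖
            = ‖(ψ t - O x (ψ t)) + O x (ψ t - ψx x t)‖ := by
              rw [map_sub]; congr 1; abel
          _ ≤ ‖ψ t - O x (ψ t)‖ + ‖O x (ψ t - ψx x t)‖ := norm_add_le _ _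
          _ ≤ _ := by rw [LinearIsometryEquiv.norm_map]; gcongr
      · rw [← map_sub, LinearIsometryEquiv.norm_map]
        refine ih.trans (Finset.sum_le_sum_of_subset_of_nonneg ?_
          (fun _ _ _ => norm_nonneg _))
        intro s
        simp only [Finset.mem_filter, Finset.mem_Icc]
        rintro ⟨h1, h2, h3⟩
        exact ⟨h1, h2, by omega⟩
  have hST : S.filter (fun s => s ∈ Finset.Icc 1 T) = S :=
    Finset.filter_true_of_mem fun s hs => hS hs
  calc ∑ x : Fin N, ‖ψ T - ψx x T‖ ^ 2
      ≤ ∑ x : Fin N, (Q : ℝ) * ∑ s ∈ S, ‖ψ (s - 1) - O x (ψ (s - 1))‖ ^ 2 := by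
        refine Finset.sum_le_sum fun x _ => ?_
        have h := hd x T
        rw [hST] at h
        refine (pow_le_pow_left₀ (norm_nonneg _) h 2).trans ?_
        rw [← hScard]
        exact sq_sum_le_card_mul_sum_sq
    _ = (Q : ℝ) * ∑ s ∈ S, ∑ x : Fin N, ‖ψ (s - 1) - O x (ψ (s - 1))‖ ^ 2 := by
        rw [← Finset.mul_sum, Finset.sum_comm]
    _ ≤ (Q : ℝ) * ∑ s ∈ S, (4 : ℝ) := by
        gcongr with s hs
        have := sum_oracle_diff_le O hO (ψ (s - 1))
        rw [hnorm] at this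
        linarith
    _ = 4 * (Q : ℝ) ^ 2 := by
        rw [Finset.sum_const, hScard, nsmul_eq_mul]; ring
end

section
/- Let N ≥ 2 and let g : Fin N → Fin N be almost injective, i.e., there exists exactly one unordered pair {x₁, x₂} of distinct inputs with g(x₁) = g(x₂), and g takes distinct values on every other pair of distinct inputs. Then the number of pairs (x, v) ∈ Fin N × Fin N with v ≠ g(x) such that the function obtained from g by redefining its value at x to be v is injective, equals exactly 2. -/
/-- Adversary count `m′ = 2` for element distinctness. Let `N ≥ 2` and let
`g : Fin N → Fin N` be almost injective: there is exactly one unordered pair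
`{a, b}` of distinct inputs with `g a = g b`, and `g` takes distinct values on every
other pair of distinct inputs. Then there are exactly `2` pairs `(x, v)` with
`v ≠ g x` such that updating `g` at `x` to the value `v` yields an injective
function. -/
theorem stmt_11 (N : ℕ) (hN : 2 ≤ N) (g : Fin N → Fin N)
    (halmost : ∃ a b : Fin N, a ≠ b ∧ g a = g b ∧
      ∀ x y : Fin N, x ≠ y → g x = g y → (x = a ∧ y = b) ∨ (x = b ∧ y = a)) :
    (Finset.univ.filter (fun p : Fin N × Fin N =>
        p.2 ≠ g p.1 ∧ Function.Injective (Function.update g p.1 p.2))).card = 2 := by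
  obtain ⟨a, b, hab, hg, hu⟩ := halmost
  have hns : ¬ Function.Surjective g := fun h =>
    hab ((Finite.injective_iff_surjective.mpr h) hg)
  obtain ⟨m, hm⟩ : ∃ m, ∀ x, g x ≠ m := by
    simpa [Function.Surjective] using hns
  have ha : Function.Injective (Function.update g a m) := by
    intro x y hxy
    by_contra hne
    have h1 := hu x y hne
    have h2 := hm x
    have h3 := hm y
    simp only [Function.update_apply] at hxy
    grind
  have hb : Function.Injective (Function.update g b m) := by
    intro x y hxy
    by_contra hne
    have h1 := hu x y hne
    have h2 := hm x
    have h3 := hm y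
    simp only [Function.update_apply] at hxy
    grind
  have hs := Finite.injective_iff_surjective.mp ha
  have key : (Finset.univ.filter (fun p : Fin N × Fin N =>
        p.2 ≠ g p.1 ∧ Function.Injective (Function.update g p.1 p.2))) = {(a, m), (b, m)} := by
    ext ⟨x, v⟩
    simp only [Finset.mem_filter, Finset.mem_univ, true_and, Finset.mem_insert,
      Finset.mem_singleton, Prod.mk.injEq]
    constructor
    · rintro ⟨hv, hinj⟩
      have hx : x = a ∨ x = b := by
        by_contra hx
        push Not at hx
        exact hab (hinj (by
          rw [Function.update_of_ne hx.1.symm, Function.update_of_ne hx.2.symm, hg]))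
      obtain ⟨y, hy⟩ := hs v
      have hyx : y ≠ x → g y ≠ v := by
        intro hne h
        exact hne (hinj (by rw [Function.update_of_ne hne, Function.update_self, h]))
      simp only [Function.update_apply] at hy
      grind
    · rintro (⟨rfl, rfl⟩ | ⟨rfl, rfl⟩)
      · exact ⟨(hm _).symm, ha⟩
      · exact ⟨(hm _).symm, hb⟩
  rw [key, Finset.card_pair]
  simpa using hab
end
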